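/- Let d ≥ 0, n > d, and let T = {T_1,…,T_l} ∈ L(n,d) with l ≥ 1. Then the poset ideal I_{n,d}(T) is isomorphic, as a poset, to the direct product ∏_{i=1}^l L(n − |T_i|, d − |T_i|), equipped with the componentwise partial order (note that n − |T_i| > d − |T_i| ≥ 0 for each i). -/

import Mathlib

attribute [local instance] Classical.propDecidable

/-- Collections of subsets of `{1,…,n}` (modelled as `Fin n`). -/
abbrev Coll (n : ℕ) := Finset (Finset (Fin n))

/-- `codim_d X = d + 1 - |X|`. -/
def codim {n : ℕ} (d : ℕ) (X : Finset (Fin n)) : ℤ := (d : ℤ) + 1 - X.card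

/-- `ρ_d T = Σ_{X ∈ T} codim_d X`. -/
def rho {n : ℕ} (d : ℕ) (T : Coll n) : ℤ := ∑ X ∈ T, codim d X

/-- `D_d T = codim_d (T_1 ∩ … ∩ T_l) - ρ_d T` (used when `|T| ≥ 2`). -/
def Dd {n : ℕ} (d : ℕ) (T : Coll n) : ℤ := codim d (T.inf id) - rho d T

/-- Membership in the lattice `L(n,d)`. -/
def memL (n d : ℕ) (T : Coll n) : Prop :=
  (∀ T' ⊆ T, 2 ≤ T'.card → 0 < Dd d T') ∧ ∀ X ∈ T, X.card ≤ d

/-- The intersection lattice `L(n,d)`. -/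
structure L (n d : ℕ) where
  val : Coll n
  mem : memL n d val

namespace L

instance (n d : ℕ) : PartialOrder (L n d) where
  le S T := S = T ∨ (rho d S.val < rho d T.val ∧ ∀ X ∈ S.val, ∃ Y ∈ T.val, Y ⊆ X)
  le_refl S := Or.inl rfl
  le_trans S T U hST hTU := by
    rcases hST with rfl | hST
    · exact hTU
    · rcases hTU with rfl | hTU
      · exact Or.inr hST
      · refine Or.inr ⟨hST.1.trans hTU.1, fun X hX => ?_⟩
        obtain ⟨Y, hY, hYX⟩ := hST.2 X hX
        obtain ⟨Z, hZ, hZY⟩ := hTU.2 Y hY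
        exact ⟨Z, hZ, hZY.trans hYX⟩
  le_antisymm S T hST hTS := by
    rcases hST with rfl | hST
    · rfl
    · rcases hTS with rfl | hTS
      · rfl
      · exact absurd (hST.1.trans hTS.1) (lt_irrefl _)

noncomputable instance (n d : ℕ) : Fintype (L n d) :=
  Fintype.ofInjective (fun T : L n d => T.val)
    (fun a b h => by cases a; cases b; simpa using h)

end L

/-- The minimum element `∅` of `L(n,d)`. -/
def Lbot (n d : ℕ) : L n d :=
  ⟨∅, by
    constructor
    · intro T' hT' h2
      rw [Finset.subset_empty] at hT'
      subst hT'
      simp at h2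
    · intro X hX
      simp at hX⟩

/-- The maximum element `{∅}` of `L(n,d)`. -/
def Ltop (n d : ℕ) : L n d :=
  ⟨{∅}, by
    constructor
    · intro T' hT' h2
      have h1 : T'.card ≤ 1 := (Finset.card_le_card hT').trans_eq (Finset.card_singleton _)
      exact absurd h2 (by omega)
    · intro X hX
      rw [Finset.mem_singleton] at hX
      subst hX
      simp⟩

/-- The singleton collection `{X}` as an element of `L(n,d)`. -/
def singL (n d : ℕ) (X : Finset (Fin n)) (hX : X.card ≤ d) : L n d :=
  ⟨{X}, by
    constructor
    · intro T' hT' h2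
      have h1 : T'.card ≤ 1 := (Finset.card_le_card hT').trans_eq (Finset.card_singleton _)
      exact absurd h2 (by omega)
    · intro Y hY
      rw [Finset.mem_singleton] at hY
      subst hY
      exact hX⟩

/-- The type of `T ∈ L(n,d)`: the multiset of codimensions of its members. -/
def typeOf {n : ℕ} (d : ℕ) (T : L n d) : Multiset ℕ :=
  T.val.val.map (fun X => d + 1 - X.card)

/-- `λ_{n,d}(γ)`: the number of elements of `L(n,d)` of type `γ`. -/
noncomputable def lam (n d : ℕ) (γ : Multiset ℕ) : ℕ :=
  (Finset.univ.filter (fun T : L n d => typeOf d T = γ)).card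

/-- `κ_{n,d}(m,T)`: the number of `m`-element sets of `d`-element subsets of `{1,…,n}`
whose corresponding hyperplanes have least upper bound `T` in `L(n,d)`. -/
noncomputable def kappa (n d m : ℕ) (T : L n d) : ℕ :=
  (Finset.univ.filter (fun H : Coll n =>
      H.card = m ∧ (∀ X ∈ H, X.card = d) ∧
      IsLUB {S : L n d | ∃ X ∈ H, S.val = {X}} T)).card

section Helpers

variable {n d : ℕ}

theorem memL.mono {S S' : Coll n} (h : memL n d S) (hS : S' ⊆ S) : memL n d S' :=
  ⟨fun P hP => h.1 P (hP.trans hS), fun X hX => h.2 X (hS hX)⟩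

theorem memL.rho_le_codim_inf {S : Coll n} (h : memL n d S) (hS : S.Nonempty) :
    rho d S ≤ codim d (S.inf id) := by
  rcases Nat.lt_or_ge S.card 2 with h1 | h2
  · obtain ⟨X, rfl⟩ := Finset.card_eq_one.1
      (le_antisymm (Nat.lt_succ_iff.1 h1) (Finset.card_pos.2 hS))
    simp [rho]
  · have := h.1 S subset_rfl h2
    unfold Dd at this
    linarith

theorem codim_anti {X Y : Finset (Fin n)} (h : X ⊆ Y) : codim d Y ≤ codim d X := by
  have := Finset.card_le_card h
  unfold codim
  omega

theorem memL.eq_singleton_or_rho_lt {S : Coll n} (h : memL n d S) {Y : Finset (Fin n)}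
    (hY : Y.card ≤ d) (hS : ∀ X ∈ S, Y ⊆ X) : S = {Y} ∨ rho d S < codim d Y := by
  rcases Nat.lt_or_ge S.card 2 with h1 | h2
  · rcases S.eq_empty_or_nonempty with rfl | hne
    · right
      simp only [rho, Finset.sum_empty, codim]
      omega
    · obtain ⟨X, rfl⟩ := Finset.card_eq_one.1
        (le_antisymm (Nat.lt_succ_iff.1 h1) (Finset.card_pos.2 hne))
      rcases (hS X (Finset.mem_singleton_self X)).eq_or_ssubset with rfl | hlt
      · exact Or.inl rfl
      · right
        have := Finset.card_lt_card hlt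
        simp only [rho, Finset.sum_singleton, codim]
        omega
  · right
    have h3 := h.1 S subset_rfl h2
    have h4 : codim d (S.inf id) ≤ codim d Y := codim_anti (Finset.le_inf hS)
    unfold Dd at h3
    linarith

/-- Distinct members of `T ∈ L(n,d)` are not both contained in a set of size at most `d`. -/
theorem memL.eq_of_subset {T : Coll n} (h : memL n d T) {X Y Z : Finset (Fin n)}
    (hX : X ∈ T) (hY : Y ∈ T) (hZ : Z.card ≤ d) (hXZ : X ⊆ Z) (hYZ : Y ⊆ Z) : X = Y := by
  by_contra hne
  have h1 := h.1 {X, Y} (by simp [Finset.insert_subset_iff, hX, hY])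
    (Finset.card_pair hne).ge
  have h2 : ({X, Y} : Coll n).inf id = X ∩ Y := by simp
  have h3 : rho d {X, Y} = codim d X + codim d Y := Finset.sum_pair hne
  have h4 := Finset.card_union_add_card_inter X Y
  have h5 := Finset.card_le_card (Finset.union_subset hXZ hYZ)
  rw [Dd, h2, h3] at h1
  unfold codim at h1
  omega

/-- The order on `L(n,d)` is reverse refinement; the condition on `ρ_d` is automatic. -/
theorem L.le_iff {S T : L n d} : S ≤ T ↔ ∀ X ∈ S.val, ∃ Y ∈ T.val, Y ⊆ X := by
  constructor
  · rintro (rfl | h)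
    · exact fun X hX => ⟨X, hX, subset_rfl⟩
    · exact h.2
  · intro h
    by_cases hST : S = T
    · exact Or.inl hST
    refine Or.inr ⟨?_, h⟩
    choose! φ hφ hsub using h
    have hfib (Y) (hY : Y ∈ T.val) : S.val.filter (φ · = Y) = {Y} ∨
        rho d (S.val.filter (φ · = Y)) < codim d Y := by
      refine (S.mem.mono (Finset.filter_subset _ _)).eq_singleton_or_rho_lt (T.mem.2 Y hY) ?_
      intro X hX
      obtain ⟨hXS, rfl⟩ := Finset.mem_filter.1 hX
      exact hsub X hXS
    rw [rho, ← Finset.sum_fiberwise_of_maps_to hφ (codim d)]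
    refine Finset.sum_lt_sum (fun Y hY => ?_) ?_
    · rcases hfib Y hY with h1 | h1
      · rw [h1, Finset.sum_singleton]
      · exact h1.le
    · by_contra! hall
      have hall' (Y) (hY : Y ∈ T.val) : S.val.filter (φ · = Y) = {Y} :=
        (hfib Y hY).resolve_right (hall Y hY).not_gt
      apply hST
      have hval : S.val = T.val := by
        ext X
        constructor
        · intro hX
          have h1 : X ∈ S.val.filter (φ · = φ X) := Finset.mem_filter.2 ⟨hX, rfl⟩
          rw [hall' _ (hφ X hX), Finset.mem_singleton] at h1
          exact h1 ▸ hφ X hX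
        · intro hX
          have h1 : X ∈ S.val.filter (φ · = X) := by
            rw [hall' X hX]
            exact Finset.mem_singleton_self X
          exact (Finset.mem_filter.1 h1).1
      cases S
      cases T
      congr

/-- Enlarging the members of a family lowers the codimension of the intersection by at most
the total decrease of the codimensions of the members. -/
theorem codim_inf_sub_sum_le {J : Coll n} {A : Finset (Fin n) → Finset (Fin n)}
    (hA : ∀ X ∈ J, X ⊆ A X) :
    codim d (J.inf id) - rho d J ≤ codim d (J.inf A) - ∑ X ∈ J, codim d (A X) := by
  have h1 : J.inf A ⊆ J.inf id ∪ J.biUnion (fun X => A X \ X) := by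
    intro x hx
    simp only [Finset.mem_union, Finset.mem_biUnion, Finset.mem_sdiff, Finset.mem_inf, id] at hx ⊢
    by_contra! hcon
    obtain ⟨X, hX, hxX⟩ := hcon.1
    exact hxX (hcon.2 X hX (hx X hX))
  have h2 : (J.inf A).card ≤ (J.inf id).card + ∑ X ∈ J, (A X \ X).card :=
    (Finset.card_le_card h1).trans ((Finset.card_union_le _ _).trans
      (Nat.add_le_add_left Finset.card_biUnion_le _))
  have h3 : ∑ X ∈ J, codim d (A X) = rho d J - ((∑ X ∈ J, (A X \ X).card : ℕ) : ℤ) := by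
    rw [rho, Nat.cast_sum, ← Finset.sum_sub_distrib]
    refine Finset.sum_congr rfl fun X hX => ?_
    have := Finset.card_sdiff_add_card_eq_card (hA X hX)
    unfold codim
    omega
  rw [h3]
  unfold codim
  omega

/-- A collection refining `T ∈ L(n,d)` lies in `L(n,d)` as soon as its parts above the members
of `T` do. -/
theorem memL.of_parts {T S : Coll n} (hT : memL n d T) (hS : ∀ Y ∈ S, ∃ X ∈ T, X ⊆ Y)
    (hparts : ∀ X ∈ T, memL n d (S.filter (X ⊆ ·))) : memL n d S := by
  choose! φ hφ hsub using hS
  refine ⟨fun S' hS' hcard => ?_, fun Y hY =>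
    (hparts _ (hφ Y hY)).2 Y (Finset.mem_filter.2 ⟨hY, hsub Y hY⟩)⟩
  let P : Finset (Fin n) → Coll n := fun X => S'.filter (φ · = X)
  have hP (X) (hX : X ∈ T) : memL n d (P X) := by
    refine (hparts X hX).mono fun Y hY => ?_
    obtain ⟨hYS, rfl⟩ := Finset.mem_filter.1 hY
    exact Finset.mem_filter.2 ⟨hS' hYS, hsub Y (hS' hYS)⟩
  have hJT : S'.image φ ⊆ T := Finset.image_subset_iff.2 fun Y hY => hφ Y (hS' hY)
  rcases Nat.lt_or_ge (S'.image φ).card 2 with h1 | h2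
  · have hne : S'.Nonempty := Finset.card_pos.1 (by omega)
    obtain ⟨X, hX⟩ := Finset.card_eq_one.1
      (le_antisymm (Nat.lt_succ_iff.1 h1) (Finset.card_pos.2 (hne.image φ)))
    refine (hP X (hJT (by simp [hX]))).1 S' (fun Y hY => Finset.mem_filter.2 ⟨hY, ?_⟩) hcard
    simpa [hX] using Finset.mem_image_of_mem φ hY
  · have hD := hT.1 _ hJT h2
    have hA : ∀ X ∈ S'.image φ, X ⊆ (P X).inf id := by
      intro X _
      refine Finset.le_inf fun Y hY => ?_
      obtain ⟨hYS, rfl⟩ := Finset.mem_filter.1 hY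
      exact hsub Y (hS' hYS)
    have h3 := codim_inf_sub_sum_le (d := d) hA
    have h4 : rho d S' ≤ ∑ X ∈ S'.image φ, codim d ((P X).inf id) := by
      rw [rho, ← Finset.sum_fiberwise_of_maps_to
        (fun Y hY => Finset.mem_image_of_mem φ hY) (codim d)]
      refine Finset.sum_le_sum fun X hX => (hP X (hJT hX)).rho_le_codim_inf ?_
      obtain ⟨Y, hY, rfl⟩ := Finset.mem_image.1 hX
      exact ⟨Y, Finset.mem_filter.2 ⟨hY, rfl⟩⟩
    have h5 : codim d ((S'.image φ).inf fun X => (P X).inf id) ≤ codim d (S'.inf id) := by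
      exact codim_anti (Finset.le_inf fun X _ => Finset.inf_mono (Finset.filter_subset _ _))
    unfold Dd at hD ⊢
    linarith

/-- The order embedding of the subsets of `{1,…,n - |X|}` onto the subsets of `{1,…,n}`
containing `X`. -/
noncomputable def liftSet (X : Finset (Fin n)) (A : Finset (Fin (n - X.card))) :
    Finset (Fin n) :=
  X ∪ A.map (Xᶜ.orderEmbOfFin (by simp [Finset.card_compl])).toEmbedding

variable (X : Finset (Fin n))

theorem subset_liftSet (A : Finset (Fin (n - X.card))) : X ⊆ liftSet X A :=
  Finset.subset_union_left

theorem disjoint_map_orderEmbOfFin_compl (h : Xᶜ.card = n - X.card)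
    (A : Finset (Fin (n - X.card))) :
    Disjoint X (A.map (Xᶜ.orderEmbOfFin h).toEmbedding) := by
  rw [Finset.disjoint_left]
  intro x hx hx'
  obtain ⟨a, -, rfl⟩ := Finset.mem_map.1 hx'
  exact Finset.mem_compl.1 (Finset.orderEmbOfFin_mem Xᶜ h a) hx

theorem card_liftSet (A : Finset (Fin (n - X.card))) :
    (liftSet X A).card = X.card + A.card := by
  rw [liftSet, Finset.card_union_of_disjoint (disjoint_map_orderEmbOfFin_compl X _ A),
    Finset.card_map]

theorem liftSet_subset_liftSet {A B : Finset (Fin (n - X.card))} :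
    liftSet X A ⊆ liftSet X B ↔ A ⊆ B := by
  constructor
  · intro h
    rw [← Finset.map_subset_map]
    exact (disjoint_map_orderEmbOfFin_compl X _ A).symm.left_le_of_le_sup_left
      (Finset.subset_union_right.trans h)
  · intro h
    exact Finset.union_subset_union_right (Finset.map_subset_map.2 h)

theorem liftSet_injective : Function.Injective (liftSet X) := fun _ _ h =>
  ((liftSet_subset_liftSet X).1 h.le).antisymm ((liftSet_subset_liftSet X).1 h.ge)

theorem exists_liftSet_eq {Y : Finset (Fin n)} (h : X ⊆ Y) : ∃ A, liftSet X A = Y := by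
  have hc : Xᶜ.card = n - X.card := by simp [Finset.card_compl]
  refine ⟨Finset.univ.filter (fun a => Xᶜ.orderEmbOfFin hc a ∈ Y), ?_⟩
  ext y
  simp only [liftSet, Finset.mem_union, Finset.mem_map, Finset.mem_filter, Finset.mem_univ,
    true_and]
  constructor
  · rintro (hy | ⟨a, ha, rfl⟩)
    · exact h hy
    · exact ha
  · intro hy
    by_cases hyX : y ∈ X
    · exact Or.inl hyX
    · have : y ∈ Set.range (Xᶜ.orderEmbOfFin hc) := by
        rw [Finset.range_orderEmbOfFin]
        simpa using hyX
      obtain ⟨a, rfl⟩ := this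
      exact Or.inr ⟨a, hy, rfl⟩

theorem liftSet_inter (A B : Finset (Fin (n - X.card))) :
    liftSet X (A ∩ B) = liftSet X A ∩ liftSet X B := by
  rw [liftSet, liftSet, liftSet, Finset.map_inter, Finset.union_inter_distrib_left]

theorem inf_image_liftSet {S : Coll (n - X.card)} (hS : S.Nonempty) :
    (S.image (liftSet X)).inf id = liftSet X (S.inf id) := by
  induction hS using Finset.Nonempty.cons_induction with
  | singleton A => simp
  | cons A S hA hS ih =>
    rw [Finset.cons_eq_insert, Finset.image_insert, Finset.inf_insert, Finset.inf_insert, ih]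
    exact (liftSet_inter X _ _).symm

variable {X}

theorem codim_liftSet (hX : X.card ≤ d) (A : Finset (Fin (n - X.card))) :
    codim d (liftSet X A) = codim (d - X.card) A := by
  rw [codim, codim, card_liftSet]
  omega

theorem Dd_image_liftSet (hX : X.card ≤ d) {S : Coll (n - X.card)} (hS : S.Nonempty) :
    Dd d (S.image (liftSet X)) = Dd (d - X.card) S := by
  rw [Dd, Dd, inf_image_liftSet X hS, codim_liftSet hX, rho, rho,
    Finset.sum_image (liftSet_injective X).injOn]
  simp only [codim_liftSet hX]

theorem memL_image_liftSet (hX : X.card ≤ d) {S : Coll (n - X.card)} :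
    memL n d (S.image (liftSet X)) ↔ memL (n - X.card) (d - X.card) S := by
  constructor
  · intro h
    refine ⟨fun P hP hcard => ?_, fun A hA => ?_⟩
    · rw [← Dd_image_liftSet hX (Finset.card_pos.1 (by omega))]
      refine h.1 _ (Finset.image_subset_image hP) ?_
      rwa [Finset.card_image_of_injective _ (liftSet_injective X)]
    · have := h.2 _ (Finset.mem_image_of_mem _ hA)
      rw [card_liftSet] at this
      omega
  · intro h
    refine ⟨fun P hP hcard => ?_, fun Y hY => ?_⟩
    · obtain ⟨Q, hQ, rfl⟩ := Finset.subset_image_iff.1 hP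
      rw [Finset.card_image_of_injective _ (liftSet_injective X)] at hcard
      rw [Dd_image_liftSet hX (Finset.card_pos.1 (by omega))]
      exact h.1 Q hQ hcard
    · obtain ⟨A, hA, rfl⟩ := Finset.mem_image.1 hY
      have := h.2 A hA
      rw [card_liftSet]
      omega

/-- The collection with prescribed parts above the members of `T`. -/
noncomputable def glue (T : L n d)
    (a : (X : {Y : Finset (Fin n) // Y ∈ T.val}) → L (n - X.1.card) (d - X.1.card)) : Coll n :=
  Finset.univ.biUnion fun X => (a X).val.image (liftSet X.1)

theorem mem_glue {T : L n d}
    {a : (X : {Y : Finset (Fin n) // Y ∈ T.val}) → L (n - X.1.card) (d - X.1.card)}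
    {Y : Finset (Fin n)} : Y ∈ glue T a ↔ ∃ X, ∃ A ∈ (a X).val, liftSet X.1 A = Y := by
  simp only [glue, Finset.mem_biUnion, Finset.mem_univ, true_and, Finset.mem_image]

theorem eq_of_subset_liftSet (T : L n d) {X X' : {Y : Finset (Fin n) // Y ∈ T.val}}
    (a : L (n - X.1.card) (d - X.1.card)) {A : Finset (Fin (n - X.1.card))}
    (hA : A ∈ a.val) (h : X'.1 ⊆ liftSet X.1 A) : X' = X := by
  refine Subtype.ext (T.mem.eq_of_subset X'.2 X.2 ?_ h (subset_liftSet X.1 A))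
  exact ((memL_image_liftSet (T.mem.2 _ X.2)).2 a.mem).2 _ (Finset.mem_image_of_mem _ hA)

theorem memL_glue (T : L n d)
    (a : (X : {Y : Finset (Fin n) // Y ∈ T.val}) → L (n - X.1.card) (d - X.1.card)) :
    memL n d (glue T a) := by
  refine T.mem.of_parts (fun Y hY => ?_) (fun X hX => ?_)
  · obtain ⟨X, A, -, rfl⟩ := mem_glue.1 hY
    exact ⟨X.1, X.2, subset_liftSet X.1 A⟩
  · refine ((memL_image_liftSet (T.mem.2 X hX)).2 (a ⟨X, hX⟩).mem).mono fun Y hY => ?_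
    obtain ⟨hY, hXY⟩ := Finset.mem_filter.1 hY
    obtain ⟨X', A, hA, rfl⟩ := mem_glue.1 hY
    obtain rfl := eq_of_subset_liftSet T (X' := ⟨X, hX⟩) (a X') hA hXY
    exact Finset.mem_image_of_mem _ hA

end Helpers

/-- For `T = {T_1,…,T_l} ∈ L(n,d)` with `l ≥ 1`, the poset ideal
`I_{n,d}(T)` is isomorphic, as a poset, to the direct product
`∏_{i=1}^l L(n − |T_i|, d − |T_i|)` with the componentwise order. -/
theorem ideal_orderIso_prod_L (n d : ℕ) (hnd : d < n) (T : L n d)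
    (hT : T.val.Nonempty) :
    Nonempty ({S : L n d // S ≤ T} ≃o
      ((X : {Y : Finset (Fin n) // Y ∈ T.val}) →
        L (n - X.1.card) (d - X.1.card))) := by
  have hle (a) : (⟨glue T a, memL_glue T a⟩ : L n d) ≤ T := L.le_iff.2 fun Y hY => by
    obtain ⟨X, A, -, rfl⟩ := mem_glue.1 hY
    exact ⟨X.1, X.2, subset_liftSet X.1 A⟩
  let g : ((X : {Y : Finset (Fin n) // Y ∈ T.val}) → L (n - X.1.card) (d - X.1.card)) →
      {S : L n d // S ≤ T} := fun a => ⟨⟨glue T a, memL_glue T a⟩, hle a⟩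
  have hg (a b) : g a ≤ g b ↔ a ≤ b := by
    rw [← Subtype.coe_le_coe, L.le_iff, Pi.le_def]
    constructor
    · intro h X
      refine L.le_iff.2 fun A hA => ?_
      obtain ⟨Y, hY, hYA⟩ := h _ (mem_glue.2 ⟨X, A, hA, rfl⟩)
      obtain ⟨X', B, hB, rfl⟩ := mem_glue.1 hY
      obtain rfl := eq_of_subset_liftSet T (a X) hA ((subset_liftSet X'.1 B).trans hYA)
      exact ⟨B, hB, (liftSet_subset_liftSet _).1 hYA⟩
    · intro h Y hY
      obtain ⟨X, A, hA, rfl⟩ := mem_glue.1 hY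
      obtain ⟨B, hB, hBA⟩ := L.le_iff.1 (h X) A hA
      exact ⟨_, mem_glue.2 ⟨X, B, hB, rfl⟩, (liftSet_subset_liftSet _).2 hBA⟩
  have hsurj : Function.Surjective g := by
    rintro ⟨S, hS⟩
    refine ⟨fun X => ⟨Finset.univ.filter fun A => liftSet X.1 A ∈ S.val,
      (memL_image_liftSet (T.mem.2 _ X.2)).1 (S.mem.mono ?_)⟩, ?_⟩
    · exact Finset.image_subset_iff.2 fun A hA => (Finset.mem_filter.1 hA).2
    · refine Subtype.ext ?_
      obtain ⟨S, hSmem⟩ := S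
      simp only [g, L.mk.injEq]
      ext Y
      simp only [mem_glue, Finset.mem_filter, Finset.mem_univ, true_and]
      constructor
      · rintro ⟨X, A, hA, rfl⟩
        exact hA
      · intro hY
        obtain ⟨X, hX, hXY⟩ := L.le_iff.1 hS Y hY
        obtain ⟨A, rfl⟩ := exists_liftSet_eq X hXY
        exact ⟨⟨X, hX⟩, A, hY, rfl⟩
  exact ⟨(RelIso.ofSurjective (OrderEmbedding.ofMapLEIff g hg) hsurj).symm⟩
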